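/- Let M be a positively t-determined S-module with r^*M ≠ 0. If M is Cohen-Macaulay, then r^*M is Cohen-Macaulay and dim r^*M = dim M. -/

import Mathlib

open MvPolynomial

noncomputable def mono (K : Type) [Field K] {n : ℕ} (a : Fin n → ℕ) : MvPolynomial (Fin n) K :=
  monomial (Finsupp.equivFunOnFinite.symm a) 1

def rmap {n : ℕ} (t a : Fin n → ℕ) : Fin n → ℕ := fun i => if 0 < a i then t i else 0

def sqrtv {n : ℕ} (a : Fin n → ℕ) : Fin n → ℕ := fun i => if 0 < a i then 1 else 0

structure MultiGrading (K : Type) [Field K] (n : ℕ) (M : Type) [AddCommGroup M]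
    [Module (MvPolynomial (Fin n) K) M] [Module K M]
    [IsScalarTower K (MvPolynomial (Fin n) K) M] where
  g : (Fin n → ℕ) → Submodule K M
  internal : DirectSum.IsInternal g
  compat : ∀ a b : Fin n → ℕ, ∀ m ∈ g a, mono K b • m ∈ g (a + b)

variable {K : Type} [Field K] {n : ℕ}

def PosDetermined {M : Type} [AddCommGroup M] [Module (MvPolynomial (Fin n) K) M] [Module K M]
    [IsScalarTower K (MvPolynomial (Fin n) K) M] (G : MultiGrading K n M) (t : Fin n → ℕ) : Prop :=
  ∀ (a : Fin n → ℕ) (i : Fin n), t i ≤ a i →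
    Set.BijOn (fun m => (X i : MvPolynomial (Fin n) K) • m) (G.g a : Set M) (G.g (a + Pi.single i 1) : Set M)

def IsRStar {M N : Type} [AddCommGroup M] [Module (MvPolynomial (Fin n) K) M] [Module K M]
    [IsScalarTower K (MvPolynomial (Fin n) K) M]
    [AddCommGroup N] [Module (MvPolynomial (Fin n) K) N] [Module K N]
    [IsScalarTower K (MvPolynomial (Fin n) K) N]
    (t : Fin n → ℕ) (G : MultiGrading K n M) (H : MultiGrading K n N) : Prop :=
  ∃ e : (Fin n → ℕ) → (M →ₗ[K] N),
    (∀ a, Set.InjOn (e a) (G.g (rmap t a))) ∧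
    (∀ a, e a '' (G.g (rmap t a)) = (H.g a : Set N)) ∧
    (∀ a b : Fin n → ℕ, ∀ m ∈ G.g (rmap t a),
      e (a + b) (mono K (rmap t (a + b) - rmap t a) • m) = mono K b • e a m)

noncomputable def mdim (R : Type) [CommRing R] (M : Type) [AddCommGroup M] [Module R M] :
    WithBot ℕ∞ :=
  ringKrullDim (R ⧸ (⊤ : Submodule R M).annihilator)

noncomputable def mdepth (K : Type) [Field K] (n : ℕ) (M : Type) [AddCommGroup M] [Module (MvPolynomial (Fin n) K) M] : ℕ :=
  sSup {k : ℕ | ∃ rs : List (MvPolynomial (Fin n) K), rs.length = k ∧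
    (∀ r ∈ rs, r ∈ Ideal.span (Set.range (X : Fin n → MvPolynomial (Fin n) K))) ∧
    RingTheory.Sequence.IsRegular M rs}

noncomputable def IsCM (K : Type) [Field K] (n : ℕ) (M : Type) [AddCommGroup M] [Module (MvPolynomial (Fin n) K) M] : Prop :=
  (mdepth K n M : WithBot ℕ∞) = mdim (MvPolynomial (Fin n) K) M

section GradeTools

open Pointwise

/-- `GrAtLeast I k M`: there is an `M`-regular sequence of length `k` in `I` (weakly regular). -/
def GrAtLeast {R : Type*} [CommRing R] (I : Ideal R) :
    ℕ → ∀ (M : Type) [AddCommGroup M] [Module R M], Prop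
  | 0, _, _, _ => True
  | k + 1, M, _, _ => ∃ x ∈ I, IsSMulRegular M x ∧ GrAtLeast I k (QuotSMulTop x M)

theorem GrAtLeast.congr {R : Type*} [CommRing R] {I : Ideal R} (k : ℕ) :
    ∀ {M M' : Type} [AddCommGroup M] [Module R M] [AddCommGroup M'] [Module R M']
      (_ : M ≃ₗ[R] M'), GrAtLeast I k M → GrAtLeast I k M' := by
  induction k with
  | zero => intros; trivial
  | succ k ih =>
    rintro M M' _ _ _ _ e ⟨x, hx, hr, h⟩
    exact ⟨x, hx, (e.isSMulRegular_congr x).1 hr, ih (QuotSMulTop.congr x e) h⟩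

theorem grAtLeast_of_isWeaklyRegular {R : Type*} [CommRing R] {I : Ideal R} (rs : List R) :
    ∀ {M : Type} [AddCommGroup M] [Module R M], (∀ r ∈ rs, r ∈ I) →
      RingTheory.Sequence.IsWeaklyRegular M rs → GrAtLeast I rs.length M := by
  induction rs with
  | nil => intros; trivial
  | cons r rs ih =>
    intro M _ _ hI h
    rw [RingTheory.Sequence.isWeaklyRegular_cons_iff] at h
    exact ⟨r, hI r (by simp), h.1, ih (fun s hs => hI s (by simp [hs])) h.2⟩

theorem GrAtLeast.exists_list {R : Type*} [CommRing R] {I : Ideal R} (k : ℕ) :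
    ∀ {M : Type} [AddCommGroup M] [Module R M], GrAtLeast I k M →
      ∃ rs : List R, rs.length = k ∧ (∀ r ∈ rs, r ∈ I) ∧
        RingTheory.Sequence.IsWeaklyRegular M rs := by
  induction k with
  | zero => intro M _ _ _; exact ⟨[], rfl, by simp, by simp⟩
  | succ k ih =>
    rintro M _ _ ⟨x, hx, hr, h⟩
    obtain ⟨rs, h1, h2, h3⟩ := ih h
    refine ⟨x :: rs, by simp [h1], ?_, ?_⟩
    · intro r hr'
      rcases List.mem_cons.1 hr' with rfl | h
      · exact hx
      · exact h2 r h
    · rw [RingTheory.Sequence.isWeaklyRegular_cons_iff]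
      exact ⟨hr, h3⟩

theorem exists_regular_map {A B : Type*} [CommRing A] [CommRing B] [IsNoetherianRing B]
    (φ : A →+* B) (I : Ideal A) {M : Type*} [AddCommGroup M] [Module B M] [Module.Finite B M]
    (h : ∀ p ∈ associatedPrimes B M, ¬ I ≤ p.comap φ) :
    ∃ y ∈ I, IsSMulRegular M (φ y) := by
  by_contra hc
  push Not at hc
  have hsub : (I : Set A) ⊆ ⋃ p ∈ associatedPrimes B M, ((p.comap φ : Ideal A) : Set A) := by
    intro y hy
    have := hc y hy
    have h2 : φ y ∈ ⋃ p ∈ associatedPrimes B M, (p : Set B) := by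
      rw [biUnion_associatedPrimes_eq_compl_regular]
      exact this
    simpa using h2
  rw [Ideal.subset_union_prime_finite (associatedPrimes.finite B M) (⊤ : Ideal B) (⊤ : Ideal B)] at hsub
  · obtain ⟨p, hp, hle⟩ := hsub
    exact h p hp hle
  · intro p hp _ _
    have := hp.isPrime
    exact Ideal.comap_isPrime φ p

theorem exists_regular_of_socle {R : Type*} [CommRing R] [IsNoetherianRing R]
    (I : Ideal R) {M : Type*} [AddCommGroup M] [Module R M] [Module.Finite R M]
    (h : ∀ m : M, (∀ a ∈ I, a • m = 0) → m = 0) : ∃ y ∈ I, IsSMulRegular M y := by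
  refine exists_regular_map (RingHom.id R) I ?_
  intro p hp hle
  obtain ⟨hp1, m, hm⟩ := isAssociatedPrime_iff.1 hp
  have hm0 : m = 0 := by
    apply h
    intro a ha
    have : a ∈ p := hle ha
    rw [hm] at this
    simpa [Submodule.mem_colon] using this
  apply hp1.ne_top
  rw [hm, hm0]
  ext; simp [Submodule.mem_colon]

theorem quotSMulTop_mk_eq_zero_iff {R M : Type*} [CommRing R] [AddCommGroup M] [Module R M]
    (x : R) (m : M) :
    (Submodule.Quotient.mk m : QuotSMulTop x M) = 0 ↔ ∃ u : M, x • u = m := by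
  rw [Submodule.Quotient.mk_eq_zero, Submodule.mem_smul_pointwise_iff_exists]
  simp

theorem regular_quot_iff {R M : Type*} [CommRing R] [AddCommGroup M] [Module R M] (x z : R) :
    IsSMulRegular (QuotSMulTop x M) z ↔ ∀ u v : M, z • u = x • v → ∃ w, x • w = u := by
  rw [isSMulRegular_iff_right_eq_zero_of_smul]
  constructor
  · intro h u v huv
    rw [← quotSMulTop_mk_eq_zero_iff]
    apply h
    rw [← Submodule.Quotient.mk_smul, quotSMulTop_mk_eq_zero_iff]
    exact ⟨v, huv.symm⟩
  · intro h m hm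
    obtain ⟨u, rfl⟩ := Submodule.Quotient.mk_surjective _ m
    rw [← Submodule.Quotient.mk_smul, quotSMulTop_mk_eq_zero_iff] at hm
    obtain ⟨v, hv⟩ := hm
    rw [quotSMulTop_mk_eq_zero_iff]
    exact h u v hv.symm

theorem regular_swap {R M : Type*} [CommRing R] [AddCommGroup M] [Module R M] {x z : R}
    (hz : IsSMulRegular M z) (hx : IsSMulRegular M x)
    (h : IsSMulRegular (QuotSMulTop x M) z) : IsSMulRegular (QuotSMulTop z M) x := by
  rw [regular_quot_iff] at h ⊢
  intro u v huv
  obtain ⟨w, rfl⟩ := h v u huv.symm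
  refine ⟨w, hx ?_⟩
  simp only
  rw [huv, smul_comm]

/-- One half of the interchange isomorphism. -/
noncomputable def quotSwapMap {R : Type*} (M : Type*) [CommRing R] [AddCommGroup M] [Module R M]
    (x z : R) : QuotSMulTop z (QuotSMulTop x M) →ₗ[R] QuotSMulTop x (QuotSMulTop z M) :=
  Submodule.liftQ _ (QuotSMulTop.map x (Submodule.mkQ (z • (⊤ : Submodule R M)))) (by
    intro m hm
    rw [Submodule.mem_smul_pointwise_iff_exists] at hm
    obtain ⟨u, -, rfl⟩ := hm
    obtain ⟨u, rfl⟩ := Submodule.Quotient.mk_surjective _ u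
    rw [LinearMap.mem_ker, map_smul, QuotSMulTop.map_apply_mk, ← Submodule.Quotient.mk_smul]
    rw [quotSMulTop_mk_eq_zero_iff]
    refine ⟨0, ?_⟩
    rw [smul_zero, Submodule.mkQ_apply, ← Submodule.Quotient.mk_smul, eq_comm,
      quotSMulTop_mk_eq_zero_iff]
    exact ⟨u, rfl⟩)

noncomputable def quotSwap {R : Type*} (M : Type*) [CommRing R] [AddCommGroup M] [Module R M]
    (x z : R) : QuotSMulTop z (QuotSMulTop x M) ≃ₗ[R] QuotSMulTop x (QuotSMulTop z M) :=
  LinearEquiv.ofLinearMap (quotSwapMap M x z) (quotSwapMap M z x)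
    (by
      apply LinearMap.ext; intro m
      obtain ⟨u, rfl⟩ := Submodule.Quotient.mk_surjective _ m
      obtain ⟨u, rfl⟩ := Submodule.Quotient.mk_surjective _ u
      rfl)
    (by
      apply LinearMap.ext; intro m
      obtain ⟨u, rfl⟩ := Submodule.Quotient.mk_surjective _ m
      obtain ⟨u, rfl⟩ := Submodule.Quotient.mk_surjective _ u
      rfl)

theorem socle_of_regular {R M : Type*} [CommRing R] [AddCommGroup M] [Module R M] {I : Ideal R}
    {x : R} (hx : x ∈ I) (h : IsSMulRegular M x) (m : M) (hm : ∀ a ∈ I, a • m = 0) : m = 0 :=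
  (isSMulRegular_iff_right_eq_zero_of_smul.1 h) m (hm x hx)

theorem socle_quot_swap {R M : Type*} [CommRing R] [AddCommGroup M] [Module R M] {I : Ideal R}
    {x y : R} (hxI : x ∈ I) (hx : IsSMulRegular M x) (hy : IsSMulRegular M y)
    (h : ∀ m : QuotSMulTop x M, (∀ a ∈ I, a • m = 0) → m = 0) :
    ∀ m : QuotSMulTop y M, (∀ a ∈ I, a • m = 0) → m = 0 := by
  intro m hm
  obtain ⟨u, rfl⟩ := Submodule.Quotient.mk_surjective _ m
  have key : ∀ a ∈ I, ∃ v : M, y • v = a • u := by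
    intro a ha
    have := hm a ha
    rwa [← Submodule.Quotient.mk_smul, quotSMulTop_mk_eq_zero_iff] at this
  obtain ⟨w, hw⟩ := key x hxI
  have h0 := h (Submodule.Quotient.mk w) (by
    intro a ha
    rw [← Submodule.Quotient.mk_smul, quotSMulTop_mk_eq_zero_iff]
    obtain ⟨v, hv⟩ := key a ha
    refine ⟨v, hy ?_⟩
    simp only
    rw [smul_comm y x, hv, smul_comm y a, hw, smul_comm])
  rw [quotSMulTop_mk_eq_zero_iff] at h0 ⊢
  obtain ⟨w', rfl⟩ := h0
  refine ⟨w', hx ?_⟩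
  simp only
  rw [smul_comm, hw]

theorem GrAtLeast.swap {R : Type*} [CommRing R] [IsNoetherianRing R] {I : Ideal R} (k : ℕ) :
    ∀ {M : Type} [AddCommGroup M] [Module R M] [Module.Finite R M] {x y : R},
      x ∈ I → y ∈ I → IsSMulRegular M x → IsSMulRegular M y →
      GrAtLeast I k (QuotSMulTop x M) → GrAtLeast I k (QuotSMulTop y M) := by
  induction k with
  | zero => intros; trivial
  | succ k ih =>
    rintro M _ _ _ x y hxI hyI hx hy ⟨w, hwI, hw, hk⟩
    have s1 := socle_of_regular (M := QuotSMulTop x M) hwI hw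
    have s2 := socle_quot_swap hxI hx hy s1
    have s0 := socle_of_regular (M := M) hxI hx
    obtain ⟨z, hzI, hz⟩ := exists_regular_of_socle I
      (M := M × QuotSMulTop x M × QuotSMulTop y M) (by
        rintro ⟨a, b, c⟩ h
        have e1 : a = 0 := s0 a (fun r hr => (Prod.ext_iff.1 (h r hr)).1)
        have e2 : b = 0 := s1 b (fun r hr => (Prod.ext_iff.1 (Prod.ext_iff.1 (h r hr)).2).1)
        have e3 : c = 0 := s2 c (fun r hr => (Prod.ext_iff.1 (Prod.ext_iff.1 (h r hr)).2).2)
        rw [e1, e2, e3]; rfl)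
    rw [isSMulRegular_iff_right_eq_zero_of_smul] at hz
    have z0 : IsSMulRegular M z := isSMulRegular_iff_right_eq_zero_of_smul.2 fun m hm =>
      (Prod.ext_iff.1 (hz (m, 0, 0) (by simp [hm]))).1
    have z1 : IsSMulRegular (QuotSMulTop x M) z :=
      isSMulRegular_iff_right_eq_zero_of_smul.2 fun m hm =>
        (Prod.ext_iff.1 (Prod.ext_iff.1 (hz (0, m, 0) (by simp [hm]))).2).1
    have z2 : IsSMulRegular (QuotSMulTop y M) z :=
      isSMulRegular_iff_right_eq_zero_of_smul.2 fun m hm =>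
        (Prod.ext_iff.1 (Prod.ext_iff.1 (hz (0, 0, m) (by simp [hm]))).2).2
    have h1 : GrAtLeast I k (QuotSMulTop z (QuotSMulTop x M)) := ih hwI hzI hw z1 hk
    have h2 := GrAtLeast.congr k (quotSwap M x z) h1
    have h3 := ih hxI hyI (regular_swap z0 hx z1) (regular_swap z0 hy z2) h2
    exact ⟨z, hzI, z2, GrAtLeast.congr k (quotSwap M z y) h3⟩

/-- Transfer of the grade to a direct summand of a restriction of scalars. -/
theorem GrAtLeast.transfer {A B : Type*} [CommRing A] [CommRing B] [IsNoetherianRing B]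
    [Algebra A B] {I : Ideal A} {J : Ideal B} (hIJ : ∀ a ∈ I, algebraMap A B a ∈ J)
    (hrad : ∀ p : Ideal B, p.IsPrime → I ≤ p.comap (algebraMap A B) → J ≤ p) (k : ℕ) :
    ∀ {M N : Type} [AddCommGroup M] [Module B M] [Module A M] [IsScalarTower A B M]
      [Module.Finite B M] [AddCommGroup N] [Module A N]
      (ι : N →ₗ[A] M) (π : M →ₗ[A] N), (∀ x, π (ι x) = x) →
      GrAtLeast J k M → GrAtLeast I k N := by
  induction k with
  | zero => intros; trivial
  | succ k ih =>
    rintro M N _ _ _ _ _ _ _ ι π hπ ⟨x, hxJ, hx, hk⟩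
    obtain ⟨y, hyI, hy⟩ := exists_regular_map (algebraMap A B) I (M := M) (by
      intro p hp hle
      have hxp : x ∈ p := hrad p hp.isPrime hle hxJ
      have : x ∈ ⋃ p ∈ associatedPrimes B M, (p : Set B) := by
        simp only [Set.mem_iUnion]
        exact ⟨p, hp, hxp⟩
      rw [biUnion_associatedPrimes_eq_compl_regular] at this
      exact this hx)
    have hyN : IsSMulRegular N y := isSMulRegular_iff_right_eq_zero_of_smul.2 fun m hm => by
      have h1 : algebraMap A B y • ι m = 0 := by
        rw [algebraMap_smul, ← map_smul, hm, map_zero]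
      have := isSMulRegular_iff_right_eq_zero_of_smul.1 hy _ h1
      rw [← hπ m, this, map_zero]
    have hk2 := GrAtLeast.swap k hxJ (hIJ y hyI) hx hy hk
    refine ⟨y, hyI, hyN, ?_⟩
    let P : Submodule B M := (algebraMap A B y) • (⊤ : Submodule B M)
    let Q : Submodule A N := y • (⊤ : Submodule A N)
    have hι : Q ≤ (P.restrictScalars A).comap ι := by
      intro m hm
      rw [Submodule.mem_smul_pointwise_iff_exists] at hm
      obtain ⟨u, -, rfl⟩ := hm
      rw [Submodule.mem_comap, Submodule.restrictScalars_mem, map_smul, ← algebraMap_smul B]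
      exact Submodule.smul_mem_pointwise_smul _ _ _ trivial
    have hπ' : (P.restrictScalars A) ≤ Q.comap π := by
      intro m hm
      rw [Submodule.restrictScalars_mem, Submodule.mem_smul_pointwise_iff_exists] at hm
      obtain ⟨u, -, rfl⟩ := hm
      rw [Submodule.mem_comap, algebraMap_smul, map_smul]
      exact Submodule.smul_mem_pointwise_smul _ _ _ trivial
    refine ih (M := M ⧸ P)
      ((Submodule.Quotient.restrictScalarsEquiv A P).toLinearMap ∘ₗ Submodule.mapQ _ _ ι hι)
      ((Submodule.mapQ _ _ π hπ') ∘ₗ (Submodule.Quotient.restrictScalarsEquiv A P).symm.toLinearMap)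
      ?_ hk2
    intro m
    obtain ⟨u, rfl⟩ := Submodule.Quotient.mk_surjective _ m
    simp [hπ]

theorem dim_transfer {A B : Type*} [CommRing A] [CommRing B]
    [Algebra A B] [Module.Finite A B] (I : Ideal A) (J : Ideal B)
    (h : J.comap (algebraMap A B) ≤ I) : ringKrullDim (A ⧸ I) ≤ ringKrullDim (B ⧸ J) := by
  refine (ringKrullDim_le_of_surjective (Ideal.Quotient.factor h)
    (Ideal.Quotient.factor_surjective h)).trans ?_
  have hi : Algebra.IsIntegral (A ⧸ J.comap (algebraMap A B)) (B ⧸ J) := inferInstance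
  have hinj : Function.Injective (algebraMap (A ⧸ J.comap (algebraMap A B)) (B ⧸ J)) :=
    Ideal.algebraMap_quotient_injective
  refine iSup_le fun l => ?_
  obtain ⟨P, hP, hlo⟩ := Ideal.exists_ideal_over_prime_of_isIntegral (S := B ⧸ J)
    l.head.asIdeal ⊥ (by
      intro a ha
      have : a = 0 := hinj (by simpa using ha)
      simp [this])
  obtain ⟨hP, hlo⟩ := hlo
  have : P.LiesOver l.head.asIdeal := ⟨hlo.symm⟩
  obtain ⟨L, hL, -⟩ := Ideal.exists_ltSeries_of_hasGoingUp l P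
  rw [← hL]
  exact le_iSup (fun p : LTSeries (PrimeSpectrum (B ⧸ J)) => (p.length : WithBot ℕ∞)) L

theorem length_le_supportDim {R : Type*} [CommRing R] [IsNoetherianRing R] (rs : List R) :
    ∀ {M : Type} [AddCommGroup M] [Module R M] [Module.Finite R M],
      RingTheory.Sequence.IsRegular M rs → (rs.length : WithBot ℕ∞) ≤ Module.supportDim R M := by
  induction rs with
  | nil =>
    intro M _ _ _ h
    have := h.nontrivial
    have := Module.supportDim_ne_bot_of_nontrivial R M
    obtain ⟨d, hd⟩ := WithBot.ne_bot_iff_exists.1 this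
    rw [← hd]
    exact WithBot.coe_le_coe.2 (zero_le)
  | cons r rs ih =>
    intro M _ _ _ h
    rw [RingTheory.Sequence.isRegular_cons_iff] at h
    have h1 := ih h.2
    have h2 := Module.supportDim_quotSMulTop_succ_le_of_notMem_minimalPrimes (M := M) (x := r)
      (fun _ => h.1.notMem_of_mem_minimalPrimes)
    refine le_trans ?_ h2
    rw [List.length_cons, Nat.cast_succ]
    gcongr

/-- The package for a finite ring homomorphism and a semilinear direct summand. -/
theorem summand_package {A B : Type} [CommRing A] [CommRing B] [IsNoetherianRing B]
    (φ : A →+* B) (hφ : φ.Finite)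
    {I : Ideal A} {J : Ideal B} (hIJ : ∀ a ∈ I, φ a ∈ J)
    (hrad : ∀ p : Ideal B, p.IsPrime → I ≤ p.comap φ → J ≤ p)
    {M N : Type} [AddCommGroup M] [Module B M] [Module.Finite B M] [AddCommGroup N] [Module A N]
    (ι : N →+ M) (π : M →+ N) (hι : ∀ a x, ι (a • x) = φ a • ι x)
    (hπ : ∀ a x, π (φ a • x) = a • π x) (hπι : ∀ x, π (ι x) = x) :
    Module.Finite A N ∧
    ringKrullDim (A ⧸ (⊤ : Submodule A N).annihilator) ≤
      ringKrullDim (B ⧸ (⊤ : Submodule B M).annihilator) ∧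
    ∀ k, GrAtLeast J k M → GrAtLeast I k N := by
  letI : Algebra A B := φ.toAlgebra
  letI : Module A M := Module.compHom M φ
  have : IsScalarTower A B M := ⟨fun a b m => by
    change (φ a * b) • m = φ a • b • m
    rw [mul_smul]⟩
  have : Module.Finite A B := hφ
  have : Module.Finite A M := Module.Finite.trans B M
  let ι' : N →ₗ[A] M := { ι with map_smul' := hι }
  let π' : M →ₗ[A] N := { π with map_smul' := hπ }
  have h' : ∀ x, π' (ι' x) = x := hπι
  refine ⟨Module.Finite.of_surjective π' (fun x => ⟨ι' x, h' x⟩), ?_, ?_⟩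
  · refine dim_transfer _ _ ?_
    intro a ha
    rw [Ideal.mem_comap, Submodule.mem_annihilator] at ha
    rw [Submodule.mem_annihilator]
    intro n _
    rw [← h' n, ← map_smul, ← algebraMap_smul B, ha _ trivial, map_zero]
  · intro k
    exact GrAtLeast.transfer (A := A) (B := B) hIJ hrad k ι' π' h'

end GradeTools

section Summand

theorem mono_add (a b : Fin n → ℕ) : mono K (a + b) = mono K a * mono K b := by
  unfold mono
  rw [monomial_mul, one_mul]
  have : (Finsupp.equivFunOnFinite.symm (a + b)) = Finsupp.equivFunOnFinite.symm a +
      Finsupp.equivFunOnFinite.symm b := by ext; simp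
  rw [this]

theorem mono_zero : mono K (0 : Fin n → ℕ) = 1 := by
  unfold mono
  have : (Finsupp.equivFunOnFinite.symm (0 : Fin n → ℕ)) = 0 := by ext; simp
  rw [this]; rfl

theorem mono_single (i : Fin n) : mono K (Pi.single i 1 : Fin n → ℕ) = X i := by
  unfold mono X
  rw [Finsupp.equivFunOnFinite_symm_single]

theorem monomial_eq_smul_mono (u : Fin n →₀ ℕ) (c : K) :
    monomial u c = c • mono K (u : Fin n → ℕ) := by
  unfold mono
  rw [smul_monomial]
  simp

/-- The endomorphism `x_i ↦ x_i ^ t_i`. -/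
noncomputable def powMap (K : Type) [Field K] {n : ℕ} (t : Fin n → ℕ) :
    MvPolynomial (Fin n) K →ₐ[K] MvPolynomial (Fin n) K :=
  aeval (fun i => X i ^ t i)

theorem powMap_mono (t b : Fin n → ℕ) : powMap K t (mono K b) = mono K (t * b) := by
  unfold powMap mono
  rw [aeval_monomial, map_one, one_mul, Finsupp.prod_fintype _ _ (by simp), monomial_eq,
    Finsupp.prod_fintype _ _ (by simp)]
  simp [pow_mul]

theorem powMap_X (t : Fin n → ℕ) (i : Fin n) : powMap K t (X i) = X i ^ t i := by
  simp [powMap]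

theorem powMap_finite (t : Fin n → ℕ) (ht : ∀ i, 1 ≤ t i) :
    (powMap K t : MvPolynomial (Fin n) K →+* MvPolynomial (Fin n) K).Finite := by
  refine RingHom.IsIntegral.to_finite ?_ ?_
  · intro s
    induction s using MvPolynomial.induction_on with
    | C c =>
      have : (C c : MvPolynomial (Fin n) K) =
        (powMap K t : MvPolynomial (Fin n) K →+* MvPolynomial (Fin n) K) (C c) := by
        simp [powMap]
      rw [this]
      exact RingHom.isIntegralElem_map _
    | add p q hp hq => exact RingHom.IsIntegralElem.add _ hp hq
    | mul_X p i hp =>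
      refine RingHom.IsIntegralElem.mul _ hp ?_
      refine ⟨Polynomial.X ^ t i - Polynomial.C (X i),
        Polynomial.monic_X_pow_sub_C _ (by have := ht i; omega), ?_⟩
      simp [powMap]
  · have h : ((powMap K t : MvPolynomial (Fin n) K →+* MvPolynomial (Fin n) K).comp
        (algebraMap K (MvPolynomial (Fin n) K))).FiniteType := by
      have e : ((powMap K t : MvPolynomial (Fin n) K →+* MvPolynomial (Fin n) K).comp
        (algebraMap K (MvPolynomial (Fin n) K))) = algebraMap K (MvPolynomial (Fin n) K) :=
        (powMap K t).comp_algebraMap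
      rw [e, RingHom.finiteType_algebraMap]
      infer_instance
    exact RingHom.FiniteType.of_comp_finiteType h

variable {M N : Type} [AddCommGroup M] [Module (MvPolynomial (Fin n) K) M]
    [Module K M] [IsScalarTower K (MvPolynomial (Fin n) K) M]
    [AddCommGroup N] [Module (MvPolynomial (Fin n) K) N] [Module K N]
    [IsScalarTower K (MvPolynomial (Fin n) K) N]

theorem MultiGrading.induct (G : MultiGrading K n M) {p : M → Prop} (h0 : p 0)
    (hom : ∀ a, ∀ m ∈ G.g a, p m) (hadd : ∀ x y, p x → p y → p (x + y)) (m : M) : p m := by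
  have hm : m ∈ iSup G.g := by
    rw [G.internal.submodule_iSup_eq_top]; trivial
  exact Submodule.iSup_induction G.g (motive := p) hm hom h0 hadd

/-- The decomposition isomorphism. -/
noncomputable def MultiGrading.dec (G : MultiGrading K n M) : (DirectSum _ fun a => G.g a) ≃ₗ[K] M :=
  LinearEquiv.ofBijective (DirectSum.coeLinearMap G.g) G.internal

open Classical in
theorem MultiGrading.exists_lift (G : MultiGrading K n M) {P : Type} [AddCommGroup P] [Module K P]
    (f : ∀ a, G.g a →ₗ[K] P) : ∃ F : M →ₗ[K] P, ∀ a (m : G.g a), F m = f a m := by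
  refine ⟨(DirectSum.toModule K _ P f) ∘ₗ G.dec.symm.toLinearMap, ?_⟩
  intro a m
  have : G.dec.symm (m : M) = DirectSum.lof K _ (fun a => G.g a) a m := by
    rw [LinearEquiv.symm_apply_eq]
    exact (DirectSum.coeLinearMap_lof G.g a m).symm
  rw [LinearMap.comp_apply, LinearEquiv.coe_coe, this, DirectSum.toModule_lof]

theorem bijOn_mono (G : MultiGrading K n M) {t : Fin n → ℕ} (hM : PosDetermined G t) (k : ℕ) :
    ∀ c d : Fin n → ℕ, ∑ i, d i = k → (∀ i, 0 < d i → t i ≤ c i) →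
    Set.BijOn (fun m => mono K d • m) (G.g c : Set M) (G.g (c + d) : Set M) := by
  induction k with
  | zero =>
    intro c d hd _
    have : d = 0 := by
      funext i
      exact (Finset.sum_eq_zero_iff.1 hd) i (Finset.mem_univ i)
    subst this
    simp only [mono_zero, one_smul, add_zero]
    exact Set.bijOn_id _
  | succ k ih =>
    intro c d hd hc
    obtain ⟨i, hi⟩ : ∃ i, 0 < d i := by
      by_contra h
      push Not at h
      have : ∑ i, d i = 0 := Finset.sum_eq_zero fun i _ => Nat.le_zero.1 (h i)
      omega
    obtain ⟨d', rfl⟩ : ∃ d' : Fin n → ℕ, d = d' + Pi.single i 1 := by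
      refine ⟨d - (Pi.single i 1 : Fin n → ℕ), ?_⟩
      funext j
      by_cases hj : j = i
      · subst hj
        change d j = d j - (Pi.single j 1 : Fin n → ℕ) j + (Pi.single j 1 : Fin n → ℕ) j
        rw [Pi.single_eq_same]; omega
      · change d j = d j - (Pi.single i 1 : Fin n → ℕ) j + (Pi.single i 1 : Fin n → ℕ) j
        rw [Pi.single_eq_of_ne hj]; omega
    have h1 := ih c d' (by
        have e : ∑ j, (d' + Pi.single i 1 : Fin n → ℕ) j = ∑ j, d' j + ∑ j, (Pi.single i 1 : Fin n → ℕ) j :=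
          Finset.sum_add_distrib
        have e2 : ∑ j, (Pi.single i 1 : Fin n → ℕ) j = 1 := by simp
        omega) (fun j hj => hc j (lt_of_lt_of_le hj (Nat.le_add_right _ _)))
    have h2 := hM (c + d') i (le_trans (hc i hi) (Nat.le_add_right _ _))
    have h3 := h2.comp h1
    rw [← add_assoc]
    refine h3.congr ?_
    intro m _
    simp only [Function.comp]
    rw [mono_add, mono_single, mul_comm, mul_smul]

theorem exists_equivs (t : Fin n → ℕ) (ht : ∀ i, 1 ≤ t i)
    (G : MultiGrading K n M) (hM : PosDetermined G t)
    (H : MultiGrading K n N) (hN : IsRStar t G H) :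
    ∃ F : ∀ a, G.g (t * a) ≃ₗ[K] H.g a, ∀ a b (m : G.g (t * a)) (m' : G.g (t * (a + b))),
      (m' : M) = mono K (t * b) • (m : M) → (F (a + b) m' : N) = mono K b • (F a m : N) := by
  obtain ⟨e, he1, he2, he3⟩ := hN
  have hle : ∀ a, rmap t a ≤ t * a := by
    intro a i
    simp only [rmap, Pi.mul_apply]
    split_ifs with h
    · exact Nat.le_mul_of_pos_right _ h
    · exact Nat.zero_le _
  have hmono : ∀ a b, rmap t a ≤ rmap t (a + b) := by
    intro a b i
    simp only [rmap, Pi.add_apply]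
    split_ifs <;> omega
  have hb : ∀ a, Set.BijOn (fun m => mono K (t * a - rmap t a) • m) (G.g (rmap t a) : Set M)
      (G.g (t * a) : Set M) := by
    intro a
    have := bijOn_mono G hM _ (rmap t a) (t * a - rmap t a) rfl (by
      intro i hi
      simp only [rmap, Pi.sub_apply, Pi.mul_apply] at hi ⊢
      split_ifs with h
      · exact le_rfl
      · rw [if_neg h] at hi
        have : a i = 0 := by omega
        simp [this] at hi)
    rwa [add_tsub_cancel_of_le (hle a)] at this
  let f1 : ∀ a, G.g (rmap t a) →ₗ[K] G.g (t * a) := fun a =>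
    { toFun := fun m => ⟨mono K (t * a - rmap t a) • (m : M), (hb a).mapsTo m.2⟩
      map_add' := fun x y => by ext; simp
      map_smul' := fun c x => by
        ext
        simp only [Submodule.coe_smul, RingHom.id_apply]
        rw [smul_comm] }
  have hf1 : ∀ a, Function.Bijective (f1 a) := by
    intro a
    constructor
    · intro x y hxy
      exact Subtype.ext ((hb a).injOn x.2 y.2 (congrArg Subtype.val hxy))
    · intro y
      obtain ⟨x, hx, hxy⟩ := (hb a).surjOn y.2
      exact ⟨⟨x, hx⟩, Subtype.ext hxy⟩
  have hm2 : ∀ a, ∀ m ∈ G.g (rmap t a), e a m ∈ H.g a := by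
    intro a m hm
    have : e a m ∈ (H.g a : Set N) := by
      rw [← he2 a]; exact ⟨m, hm, rfl⟩
    exact this
  let f2 : ∀ a, G.g (rmap t a) →ₗ[K] H.g a := fun a => (e a).restrict (hm2 a)
  have hf2 : ∀ a, Function.Bijective (f2 a) := by
    intro a
    constructor
    · intro x y hxy
      exact Subtype.ext (he1 a x.2 y.2 (congrArg Subtype.val hxy))
    · intro y
      have hy : (y : N) ∈ e a '' (G.g (rmap t a)) := by rw [he2 a]; exact y.2
      obtain ⟨x, hx, hxy⟩ := hy
      exact ⟨⟨x, hx⟩, Subtype.ext hxy⟩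
  let F : ∀ a, G.g (t * a) ≃ₗ[K] H.g a := fun a =>
    (LinearEquiv.ofBijective (f1 a) (hf1 a)).symm.trans (LinearEquiv.ofBijective (f2 a) (hf2 a))
  have hF : ∀ a (m : G.g (rmap t a)), F a (f1 a m) = f2 a m := by
    intro a m
    have : (LinearEquiv.ofBijective (f1 a) (hf1 a)).symm (f1 a m) = m := by
      rw [LinearEquiv.symm_apply_eq]; rfl
    simp only [F, LinearEquiv.trans_apply, this]
    rfl
  refine ⟨F, ?_⟩
  intro a b m m' hmm
  obtain ⟨m0, rfl⟩ := (hf1 a).2 m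
  have hmem : mono K (rmap t (a + b) - rmap t a) • (m0 : M) ∈ G.g (rmap t (a + b)) := by
    have := G.compat _ (rmap t (a + b) - rmap t a) _ m0.2
    rwa [add_tsub_cancel_of_le (hmono a b)] at this
  have hm' : m' = f1 (a + b) ⟨_, hmem⟩ := by
    ext
    rw [hmm]
    simp only [f1, LinearMap.coe_mk, AddHom.coe_mk]
    rw [← mul_smul, ← mul_smul, ← mono_add, ← mono_add]
    congr 2
    funext i
    have h1 := hle a i
    have h2 := hle (a + b) i
    have h3 := hmono a b i
    simp only [Pi.add_apply, Pi.sub_apply, Pi.mul_apply, mul_add] at *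
    omega
  rw [hm', hF, hF]
  exact he3 a b m0 m0.2

theorem exists_summand (t : Fin n → ℕ) (ht : ∀ i, 1 ≤ t i)
    (G : MultiGrading K n M) (hM : PosDetermined G t)
    (H : MultiGrading K n N) (hN : IsRStar t G H) :
    ∃ (ι : N →ₗ[K] M) (π : M →ₗ[K] N),
      (∀ (s : MvPolynomial (Fin n) K) x, ι (s • x) = powMap K t s • ι x) ∧
      (∀ (s : MvPolynomial (Fin n) K) x, π (powMap K t s • x) = s • π x) ∧
      (∀ x, π (ι x) = x) := by
  classical
  obtain ⟨F, hF⟩ := exists_equivs t ht G hM H hN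
  have hinj : ∀ a a' : Fin n → ℕ, t * a = t * a' → a = a' := by
    intro a a' h
    funext i
    exact Nat.eq_of_mul_eq_mul_left (ht i) (congrFun h i)
  obtain ⟨ι, hι⟩ := H.exists_lift (fun a => (G.g (t * a)).subtype ∘ₗ (F a).symm.toLinearMap)
  have hι' : ∀ a (m : G.g (t * a)), ι (F a m : N) = m := by
    intro a m; rw [hι]; simp
  obtain ⟨π, hπ⟩ := G.exists_lift (fun b =>
    if h : ∃ a, t * a = b then
      (H.g h.choose).subtype ∘ₗ (F h.choose).toLinearMap ∘ₗ
        (LinearEquiv.ofEq (G.g b) (G.g (t * h.choose)) (by rw [h.choose_spec])).toLinearMap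
    else 0)
  have hFF : ∀ a a', t * a' = t * a → ∀ (m : G.g (t * a)) (m' : G.g (t * a')), (m : M) = m' →
      (F a' m' : N) = F a m := by
    intro a a' h m m' hm
    obtain rfl := hinj _ _ h
    rw [Subtype.ext hm]
  have hπ1 : ∀ a (m : G.g (t * a)), π m = F a m := by
    intro a m
    have h : ∃ a', t * a' = t * a := ⟨a, rfl⟩
    rw [hπ, dif_pos h]
    simp only [LinearMap.comp_apply, LinearEquiv.coe_coe, Submodule.subtype_apply]
    exact hFF _ _ h.choose_spec _ _ rfl
  have hπ0 : ∀ b, (¬ ∃ a, t * a = b) → ∀ m ∈ G.g b, π m = 0 := by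
    intro b hb m hm
    rw [hπ b ⟨m, hm⟩, dif_neg hb]
    rfl
  -- reduction to monomials
  have red1 : (∀ b x, ι (mono K b • x) = mono K (t * b) • ι x) →
      ∀ (s : MvPolynomial (Fin n) K) x, ι (s • x) = powMap K t s • ι x := by
    intro h s x
    induction s using MvPolynomial.induction_on' with
    | monomial u c =>
      rw [monomial_eq_smul_mono, map_smul (powMap K t), powMap_mono, smul_assoc, smul_assoc,
        LinearMap.map_smul, h]
    | add p q hp hq => rw [add_smul, map_add, map_add, add_smul, hp, hq]
  have red2 : (∀ b x, π (mono K (t * b) • x) = mono K b • π x) →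
      ∀ (s : MvPolynomial (Fin n) K) x, π (powMap K t s • x) = s • π x := by
    intro h s x
    induction s using MvPolynomial.induction_on' with
    | monomial u c =>
      rw [monomial_eq_smul_mono, map_smul (powMap K t), powMap_mono, smul_assoc, smul_assoc,
        LinearMap.map_smul, h]
    | add p q hp hq => rw [add_smul, map_add, add_smul, map_add, hp, hq]
  have hmem : ∀ a b (m : G.g (t * a)), mono K (t * b) • (m : M) ∈ G.g (t * (a + b)) := by
    intro a b m
    have := G.compat _ (t * b) _ m.2
    rwa [← mul_add] at this
  refine ⟨ι, π, red1 ?_, red2 ?_, ?_⟩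
  · intro b x
    induction x using H.induct with
    | h0 => simp
    | hom a x hx =>
      obtain ⟨m, hm⟩ := (F a).surjective ⟨x, hx⟩
      have hx' : x = (F a m : N) := by rw [hm]
      rw [hx', ← hF a b m ⟨_, hmem a b m⟩ rfl, hι', hι']
    | hadd x y hx hy => rw [smul_add, map_add, map_add, smul_add, hx, hy]
  · intro b x
    induction x using G.induct with
    | h0 => simp
    | hom c x hx =>
      by_cases h : ∃ a, t * a = c
      · obtain ⟨a, rfl⟩ := h
        have e1 := hπ1 a ⟨x, hx⟩
        have e2 := hπ1 (a + b) ⟨_, hmem a b ⟨x, hx⟩⟩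
        simp only at e1 e2
        rw [e1, e2]
        exact hF a b ⟨x, hx⟩ _ rfl
      · rw [hπ0 c h x hx, smul_zero]
        refine hπ0 (c + t * b) ?_ _ (G.compat _ _ _ hx)
        rintro ⟨a', ha'⟩
        apply h
        refine ⟨a' - b, ?_⟩
        funext i
        have := congrFun ha' i
        simp only [Pi.mul_apply, Pi.add_apply, Pi.sub_apply] at this ⊢
        rw [Nat.mul_sub]; omega
    | hadd x y hx hy => rw [smul_add, map_add, map_add, smul_add, hx, hy]
  · intro x
    induction x using H.induct with
    | h0 => simp
    | hom a x hx =>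
      obtain ⟨m, hm⟩ := (F a).surjective ⟨x, hx⟩
      have hx' : x = (F a m : N) := by rw [hm]
      rw [hx', hι', hπ1]
    | hadd x y hx hy => rw [map_add, map_add, hx, hy]

theorem irrelevant_smul_ne_top (H : MultiGrading K n N) [Nontrivial N] :
    (⊤ : Submodule (MvPolynomial (Fin n) K) N) ≠
    Ideal.span (Set.range (X : Fin n → MvPolynomial (Fin n) K)) • ⊤ := by
  classical
  intro htop
  have hex : ∃ k, ∃ a : Fin n → ℕ, ∑ i, a i = k ∧ H.g a ≠ ⊥ := by
    by_contra hc
    push Not at hc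
    obtain ⟨x, hx⟩ := exists_ne (0 : N)
    apply hx
    refine H.induct (p := fun x => x = 0) rfl ?_ ?_ x
    · intro a m hm
      rw [hc _ a rfl] at hm
      exact hm
    · intro x y hx hy; rw [hx, hy, add_zero]
  obtain ⟨a, hak, ha⟩ := Nat.find_spec hex
  have hmin : ∀ b : Fin n → ℕ, ∑ i, b i < ∑ i, a i → H.g b = ⊥ := by
    intro b hb
    by_contra hc
    rw [hak] at hb
    exact Nat.find_min hex hb ⟨b, rfl, hc⟩
  obtain ⟨q, hq⟩ := H.exists_lift (fun b => if b = a then (H.g b).subtype else 0)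
  have hqX : ∀ i (x : N), q ((X i : MvPolynomial (Fin n) K) • x) = 0 := by
    intro i x
    induction x using H.induct with
    | h0 => simp
    | hom b x hx =>
      have hmem := H.compat _ (Pi.single i 1) _ hx
      rw [mono_single] at hmem
      have h1 := hq _ ⟨_, hmem⟩
      simp only at h1
      rw [h1]
      split_ifs with h
      · have : H.g b = ⊥ := hmin b (by
          rw [← h]
          simp [Finset.sum_add_distrib])
        rw [this, Submodule.mem_bot] at hx
        simp [hx]
      · rfl
    | hadd x y hx hy => rw [smul_add, map_add, hx, hy, add_zero]
  have hqI : ∀ r ∈ Ideal.span (Set.range (X : Fin n → MvPolynomial (Fin n) K)),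
      ∀ x : N, q (r • x) = 0 := by
    intro r hr
    induction hr using Submodule.span_induction with
    | mem r hr => obtain ⟨i, rfl⟩ := hr; exact hqX i
    | zero => simp
    | add r s _ _ hr hs => intro x; rw [add_smul, map_add, hr, hs, add_zero]
    | smul s r _ hr => intro x; rw [smul_eq_mul, mul_comm, mul_smul]; exact hr _
  have hq0 : ∀ x : N, q x = 0 := by
    intro x
    have hx : x ∈ Ideal.span (Set.range (X : Fin n → MvPolynomial (Fin n) K)) •
        (⊤ : Submodule (MvPolynomial (Fin n) K) N) := by rw [← htop]; trivial
    refine Submodule.smul_induction_on hx (fun r hr m _ => hqI r hr m) ?_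
    intro x y hx hy; rw [map_add, hx, hy, add_zero]
  obtain ⟨x, hx, hx0⟩ := Submodule.exists_mem_ne_zero_of_ne_bot ha
  apply hx0
  have h2 := hq a ⟨x, hx⟩
  rw [if_pos rfl] at h2
  simp only [Submodule.subtype_apply] at h2
  rw [← h2, hq0]

end Summand

/-- if `M` is Cohen-Macaulay and `r^*M ≠ 0`, then `r^*M` is Cohen-Macaulay
and `dim r^*M = dim M`. -/
theorem rstar_CM {M N : Type} [AddCommGroup M] [Module (MvPolynomial (Fin n) K) M]
    [Module K M] [IsScalarTower K (MvPolynomial (Fin n) K) M]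
    [AddCommGroup N] [Module (MvPolynomial (Fin n) K) N] [Module K N]
    [IsScalarTower K (MvPolynomial (Fin n) K) N]
    (t : Fin n → ℕ) (ht : ∀ i, 1 ≤ t i)
    (G : MultiGrading K n M) [Module.Finite (MvPolynomial (Fin n) K) M]
    (hM : PosDetermined G t)
    (H : MultiGrading K n N) (hN : IsRStar t G H) (hN0 : Nontrivial N)
    (hCM : IsCM K n M) :
    IsCM K n N ∧ mdim (MvPolynomial (Fin n) K) N = mdim (MvPolynomial (Fin n) K) M := by
  obtain ⟨ι, π, h1, h2, h3⟩ := exists_summand t ht G hM H hN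
  obtain ⟨hfin, hdim, hgr⟩ := summand_package
    (powMap K t : MvPolynomial (Fin n) K →+* MvPolynomial (Fin n) K) (powMap_finite t ht)
    (I := Ideal.span (Set.range (X : Fin n → MvPolynomial (Fin n) K)))
    (J := Ideal.span (Set.range (X : Fin n → MvPolynomial (Fin n) K)))
    (by
      have : Ideal.span (Set.range (X : Fin n → MvPolynomial (Fin n) K)) ≤
          (Ideal.span (Set.range (X : Fin n → MvPolynomial (Fin n) K))).comap
          (powMap K t : MvPolynomial (Fin n) K →+* MvPolynomial (Fin n) K) := by
        rw [Ideal.span_le]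
        rintro _ ⟨i, rfl⟩
        change powMap K t (X i) ∈ Ideal.span (Set.range (X : Fin n → MvPolynomial (Fin n) K))
        rw [powMap_X]
        exact Ideal.pow_mem_of_mem _ (Ideal.subset_span (Set.mem_range_self i)) _ (ht i)
      exact this)
    (by
      intro p hp hle
      rw [Ideal.span_le]
      rintro _ ⟨i, rfl⟩
      have h : powMap K t (X i) ∈ p := hle (Ideal.subset_span (Set.mem_range_self i))
      rw [powMap_X] at h
      exact hp.mem_of_pow_mem _ h)
    ι.toAddMonoidHom π.toAddMonoidHom h1 h2 h3
  have hdim' : mdim (MvPolynomial (Fin n) K) N ≤ mdim (MvPolynomial (Fin n) K) M := hdim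
  have hIM : (mdepth K n M : WithBot ℕ∞) = mdim (MvPolynomial (Fin n) K) M := hCM
  -- grade of `M`
  have hM' : GrAtLeast (Ideal.span (Set.range (X : Fin n → MvPolynomial (Fin n) K)))
      (mdepth K n M) M := by
    by_cases h0 : mdepth K n M = 0
    · rw [h0]; trivial
    · have hmem : mdepth K n M ∈ {k : ℕ | ∃ rs : List (MvPolynomial (Fin n) K), rs.length = k ∧
          (∀ r ∈ rs, r ∈ Ideal.span (Set.range (X : Fin n → MvPolynomial (Fin n) K))) ∧
          RingTheory.Sequence.IsRegular M rs} := by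
        refine Nat.sSup_mem ?_ ?_
        · by_contra hc
          rw [Set.not_nonempty_iff_eq_empty] at hc
          exact h0 (by unfold mdepth; rw [hc]; simp)
        · by_contra hc
          exact h0 (by unfold mdepth; exact Nat.sSup_of_not_bddAbove hc)
      obtain ⟨rs, hl, hI, hr⟩ := hmem
      rw [← hl]
      exact grAtLeast_of_isWeaklyRegular rs hI hr.toIsWeaklyRegular
  obtain ⟨rs, hl, hI, hr⟩ := (hgr _ hM').exists_list
  have hreg : RingTheory.Sequence.IsRegular N rs := by
    refine ⟨hr, ?_⟩
    intro htop
    apply irrelevant_smul_ne_top H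
    refine le_antisymm ?_ le_top
    calc (⊤ : Submodule (MvPolynomial (Fin n) K) N) = Ideal.ofList rs • ⊤ := htop
      _ ≤ _ := Submodule.smul_mono_left (Ideal.span_le.2 hI)
  have hle : ∀ rs' : List (MvPolynomial (Fin n) K), RingTheory.Sequence.IsRegular N rs' →
      (rs'.length : WithBot ℕ∞) ≤ mdim (MvPolynomial (Fin n) K) N := by
    intro rs' h
    have := length_le_supportDim rs' h
    rw [Module.supportDim_eq_ringKrullDim_quotient_annihilator] at this
    unfold mdim
    rwa [Submodule.annihilator_top]
  have hlow := hle rs hreg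
  rw [hl] at hlow
  have heq : mdim (MvPolynomial (Fin n) K) N = (mdepth K n M : WithBot ℕ∞) :=
    le_antisymm (hdim'.trans hIM.ge) hlow
  refine ⟨?_, heq.trans hIM⟩
  unfold IsCM
  rw [heq]
  have hd : mdepth K n N = mdepth K n M := by
    have hub : ∀ k ∈ {k : ℕ | ∃ rs : List (MvPolynomial (Fin n) K), rs.length = k ∧
          (∀ r ∈ rs, r ∈ Ideal.span (Set.range (X : Fin n → MvPolynomial (Fin n) K))) ∧
          RingTheory.Sequence.IsRegular N rs}, k ≤ mdepth K n M := by
      rintro k ⟨rs', rfl, -, h⟩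
      have := hle rs' h
      rw [heq] at this
      exact_mod_cast this
    refine le_antisymm (csSup_le ⟨_, rs, hl, hI, hreg⟩ hub) (le_csSup ⟨_, hub⟩ ⟨rs, hl, hI, hreg⟩)
  rw [hd]
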